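/- arXiv:math/0104106 — 8 statements merged into one kernel-verified Lean document; each statement's English description precedes it below -/
import Mathlib

section
/- For every u ∈ C_{+,log} and every t ≥ 0, the Legendre transform ℓ_u(t) = inf_{r>0} u(r)/r^t is strictly positive (and finite). -/
open Real Filter Set

/-- The Legendre transform `ℓ_u(t) = inf_{r>0} u(r)/r^t`. -/
noncomputable def legendreTransform (u : ℝ → ℝ) (t : ℝ) : ℝ :=
  ⨅ r : Set.Ioi (0:ℝ), u r / (r : ℝ) ^ t

/-- For every `u ∈ C_{+,log}` and every `t ≥ 0`, the Legendre transform
`ℓ_u(t) = inf_{r>0} u(r)/r^t` is strictly positive (it is a real number, hence finite). -/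
theorem legendreTransform_pos (u : ℝ → ℝ)
    (hpos : ∀ r ≥ (0:ℝ), 0 < u r)
    (hcont : ContinuousOn u (Set.Ici 0))
    (hlog : Tendsto (fun r => Real.log (u r) / Real.log r) atTop atTop) :
    ∀ t ≥ (0:ℝ), 0 < legendreTransform u t := by
  intro t ht
  obtain ⟨R, hR⟩ := eventually_atTop.1 ((hlog.eventually_ge_atTop t).and (eventually_gt_atTop 1))
  have hR1 : 1 < R := (hR R le_rfl).2
  have hR0 : 0 < R := by linarith
  obtain ⟨x, hx, hmin⟩ := (isCompact_Icc (a := (0:ℝ)) (b := R)).exists_isMinOn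
    ⟨0, by simp [hR0.le]⟩ (hcont.mono Set.Icc_subset_Ici_self)
  have hm : 0 < u x := hpos x hx.1
  have hRt : 0 < R ^ t := Real.rpow_pos_of_pos hR0 t
  have hc : 0 < min 1 (u x / R ^ t) := lt_min one_pos (div_pos hm hRt)
  refine lt_of_lt_of_le hc ?_
  unfold legendreTransform
  haveI : Nonempty (Set.Ioi (0:ℝ)) := ⟨⟨1, Set.mem_Ioi.2 one_pos⟩⟩
  refine le_ciInf ?_
  rintro ⟨r, hr⟩
  have hr0 : 0 < r := hr
  have hrt : 0 < r ^ t := Real.rpow_pos_of_pos hr0 t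
  rcases le_total r R with h | h
  · refine (min_le_right _ _).trans ?_
    have h1 : u x ≤ u r := hmin ⟨hr0.le, h⟩
    have h2 : r ^ t ≤ R ^ t := Real.rpow_le_rpow hr0.le h ht
    exact div_le_div₀ (hpos r hr0.le).le h1 hrt h2
  · refine (min_le_left _ _).trans ?_
    obtain ⟨h1, h2⟩ := hR r h
    have hl : 0 < Real.log r := Real.log_pos h2
    rw [le_div_iff₀ hl] at h1
    rw [le_div_iff₀ hrt, one_mul]
    exact (Real.rpow_le_iff_le_log hr0 (hpos r hr0.le)).2 h1
end

section
/- Let u ∈ C_{+,log} be (log,exp)-convex. Then for every a > 1 and every r ≥ 0, L_u(r) ≤ (ea/log a) · u(ar). -/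
open Real Filter Set

/-- The L-function `L_u(r) = Σ_{n=0}^∞ ℓ_u(n) r^n`. -/
noncomputable def Lfunction (u : ℝ → ℝ) (r : ℝ) : ℝ :=
  ∑' n : ℕ, legendreTransform u n * r ^ n

/-- Let `u ∈ C_{+,log}` be (log,exp)-convex. Then for every `a > 1` and every
`r ≥ 0`, `L_u(r) ≤ (e a / log a) · u(a r)`. -/
theorem Lfunction_le (u : ℝ → ℝ)
    (hpos : ∀ r ≥ (0:ℝ), 0 < u r)
    (hcont : ContinuousOn u (Set.Ici 0))
    (hlog : Tendsto (fun r => Real.log (u r) / Real.log r) atTop atTop)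
    (hconv : ConvexOn ℝ Set.univ (fun x => Real.log (u (Real.exp x)))) :
    ∀ a > (1:ℝ), ∀ r ≥ (0:ℝ),
      Lfunction u r ≤ (Real.exp 1 * a / Real.log a) * u (a * r) := by
  intro a ha r hr
  have hla : 0 < Real.log a := Real.log_pos ha
  have hlog1 : Real.log a ≤ a - 1 := Real.log_le_sub_one_of_pos (by linarith)
  have he : 1 ≤ Real.exp 1 := Real.one_le_exp (by norm_num)
  have hbdd : ∀ t : ℝ, BddBelow (Set.range fun s : Set.Ioi (0:ℝ) => u s / (s : ℝ) ^ t) := by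
    intro t
    refine ⟨0, ?_⟩
    rintro _ ⟨s, rfl⟩
    exact div_nonneg (hpos s (le_of_lt s.2)).le (Real.rpow_nonneg (le_of_lt s.2) t)
  have hle : ∀ (t s : ℝ), 0 < s → legendreTransform u t ≤ u s / s ^ t := by
    intro t s hs
    exact ciInf_le (hbdd t) (⟨s, hs⟩ : Set.Ioi (0:ℝ))
  have hnn : ∀ t : ℝ, 0 ≤ legendreTransform u t := by
    intro t
    apply Real.iInf_nonneg
    intro s
    exact div_nonneg (hpos s (le_of_lt s.2)).le (Real.rpow_nonneg (le_of_lt s.2) t)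
  rcases hr.eq_or_lt with h0 | hr0
  · have h0' : r = 0 := h0.symm
    subst h0'
    have hL : Lfunction u 0 = legendreTransform u 0 := by
      unfold Lfunction
      rw [tsum_eq_single 0]
      · simp
      · intro n hn
        simp [hn]
    have hu0 : legendreTransform u 0 ≤ u 0 := by
      have hc : Tendsto u (nhdsWithin 0 (Set.Ioi 0)) (nhds (u 0)) :=
        (hcont 0 (by simp)).mono_left (nhdsWithin_mono _ Set.Ioi_subset_Ici_self)
      refine ge_of_tendsto hc ?_
      filter_upwards [self_mem_nhdsWithin] with s hs
      simpa using hle 0 s hs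
    have hC : 1 ≤ Real.exp 1 * a / Real.log a := by
      rw [le_div_iff₀ hla]
      nlinarith
    have := hpos 0 le_rfl
    rw [hL, mul_zero]
    nlinarith
  · have har : 0 < a * r := by positivity
    have hU := hpos (a * r) har.le
    have hterm : ∀ n : ℕ, legendreTransform u n * r ^ n ≤ u (a * r) * (a⁻¹) ^ n := by
      intro n
      have h1 := mul_le_mul_of_nonneg_right (hle n (a * r) har) (pow_nonneg hr n)
      refine h1.trans (le_of_eq ?_)
      rw [Real.rpow_natCast, mul_pow, inv_pow]
      have : a ^ n ≠ 0 := by positivity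
      have : r ^ n ≠ 0 := by positivity
      field_simp
    have hg : HasSum (fun n : ℕ => u (a * r) * (a⁻¹) ^ n) (u (a * r) * (1 - a⁻¹)⁻¹) :=
      (hasSum_geometric_of_lt_one (by positivity) (inv_lt_one_of_one_lt₀ ha)).mul_left _
    have hs : Summable (fun n : ℕ => legendreTransform u n * r ^ n) :=
      Summable.of_nonneg_of_le (fun n => mul_nonneg (hnn n) (pow_nonneg hr n)) hterm hg.summable
    have hL : Lfunction u r ≤ u (a * r) * (1 - a⁻¹)⁻¹ := by
      unfold Lfunction
      exact hasSum_le hterm hs.hasSum hg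
    have hC : (1 - a⁻¹)⁻¹ ≤ Real.exp 1 * a / Real.log a := by
      have h2 : (1 - a⁻¹)⁻¹ = a / (a - 1) := by
        have : a - 1 ≠ 0 := by linarith
        have : a ≠ 0 := by linarith
        rw [← inv_div]
        congr 1
        field_simp
      rw [h2, div_le_div_iff₀ (by linarith) hla]
      have h3 : a * Real.log a ≤ a * (a - 1) := mul_le_mul_of_nonneg_left hlog1 (by linarith)
      have h4 : 0 ≤ a * (a - 1) := mul_nonneg (by linarith) (by linarith)
      nlinarith
    calc Lfunction u r ≤ u (a * r) * (1 - a⁻¹)⁻¹ := hL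
      _ ≤ u (a * r) * (Real.exp 1 * a / Real.log a) := mul_le_mul_of_nonneg_left hC hU.le
      _ = _ := mul_comm _ _
end

section
/- Let u ∈ C_{+,log} be (log,exp)-convex. Then its L-function L_u is also (log,exp)-convex, i.e. x ↦ log L_u(e^x) is convex on ℝ. -/
open Real Filter Set

/-- Let `u ∈ C_{+,log}` be (log,exp)-convex. Then its L-function `L_u` is also
(log,exp)-convex, i.e. `x ↦ log L_u(e^x)` is convex on `ℝ`. -/
theorem Lfunction_logExpConvex (u : ℝ → ℝ)
    (hpos : ∀ r ≥ (0:ℝ), 0 < u r)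
    (hcont : ContinuousOn u (Set.Ici 0))
    (hlog : Tendsto (fun r => Real.log (u r) / Real.log r) atTop atTop)
    (hconv : ConvexOn ℝ Set.univ (fun x => Real.log (u (Real.exp x)))) :
    ConvexOn ℝ Set.univ (fun x => Real.log (Lfunction u (Real.exp x))) := by
  have hc : ∀ n : ℕ, 0 ≤ legendreTransform u n := by
    intro n
    apply Real.iInf_nonneg
    intro r
    exact div_nonneg (hpos r (le_of_lt r.2)).le (Real.rpow_nonneg (le_of_lt r.2) _)
  have hterm : ∀ (x : ℝ) (n : ℕ), 0 ≤ legendreTransform u n * Real.exp x ^ n :=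
    fun x n => mul_nonneg (hc n) (pow_nonneg (Real.exp_pos x).le n)
  have hsum : ∀ x : ℝ, Summable (fun n : ℕ => legendreTransform u n * Real.exp x ^ n) := by
    intro x
    have hR : 0 < 2 * Real.exp x := by positivity
    refine Summable.of_nonneg_of_le (hterm x) (f := fun n : ℕ => u (2 * Real.exp x) * (1 / 2 : ℝ) ^ n) ?_
      (summable_geometric_two.mul_left _)
    intro n
    have h1 : legendreTransform u n ≤ u (2 * Real.exp x) / (2 * Real.exp x) ^ n := by
      have hb : BddBelow (Set.range fun r : Set.Ioi (0:ℝ) => u r / (r : ℝ) ^ (n : ℝ)) := by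
        refine ⟨0, ?_⟩
        rintro _ ⟨r, rfl⟩
        exact div_nonneg (hpos r (le_of_lt r.2)).le (Real.rpow_nonneg (le_of_lt r.2) _)
      have := ciInf_le hb ⟨2 * Real.exp x, hR⟩
      simp only [Real.rpow_natCast] at this
      simpa [legendreTransform] using this
    calc legendreTransform u n * Real.exp x ^ n
        ≤ u (2 * Real.exp x) / (2 * Real.exp x) ^ n * Real.exp x ^ n := by gcongr
      _ = u (2 * Real.exp x) * (1 / 2 : ℝ) ^ n := by
        rw [mul_pow, one_div, inv_pow]
        have := (Real.exp_pos x).ne'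
        field_simp
  by_cases hz : ∀ n : ℕ, legendreTransform u n = 0
  · have h0 : (fun x => Real.log (Lfunction u (Real.exp x))) = fun _ => 0 := by
      funext x
      simp [Lfunction, hz]
    rw [h0]
    exact convexOn_const 0 convex_univ
  push Not at hz
  obtain ⟨m, hm⟩ := hz
  have hL : ∀ x, 0 < Lfunction u (Real.exp x) := fun x =>
    (hsum x).tsum_pos (hterm x) m
      (mul_pos (lt_of_le_of_ne (hc m) hm.symm) (pow_pos (Real.exp_pos x) m))
  refine ⟨convex_univ, ?_⟩
  intro x _ y _ a b ha hb hab
  simp only [smul_eq_mul]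
  set F := Lfunction u (Real.exp x) with hF
  set G := Lfunction u (Real.exp y) with hG
  have hFp : 0 < F := hL x
  have hGp : 0 < G := hL y
  rw [Real.log_le_iff_le_exp (hL _)]
  set E := Real.exp (a * Real.log F + b * Real.log G) with hE
  have key : ∀ n : ℕ, legendreTransform u n * Real.exp (a * x + b * y) ^ n ≤
      E * (a / F) * (legendreTransform u n * Real.exp x ^ n)
        + E * (b / G) * (legendreTransform u n * Real.exp y ^ n) := by
    intro n
    have h := convexOn_exp.2 (Set.mem_univ (n * x - Real.log F))
      (Set.mem_univ (n * y - Real.log G)) ha hb hab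
    simp only [smul_eq_mul] at h
    rw [Real.exp_sub, Real.exp_sub, Real.exp_log hFp, Real.exp_log hGp, Real.exp_nat_mul,
      Real.exp_nat_mul] at h
    have h2 : Real.exp (a * x + b * y) ^ n =
        E * Real.exp (a * (n * x - Real.log F) + b * (n * y - Real.log G)) := by
      rw [hE, ← Real.exp_add, ← Real.exp_nat_mul]
      congr 1
      ring
    rw [h2]
    calc _ ≤ legendreTransform u n * (E * (a * (Real.exp x ^ n / F) + b * (Real.exp y ^ n / G))) :=
          mul_le_mul_of_nonneg_left (mul_le_mul_of_nonneg_left h (Real.exp_pos _).le) (hc n)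
      _ = _ := by ring
  have hs := (hsum (a * x + b * y)).tsum_le_tsum key
    (((hsum x).mul_left _).add ((hsum y).mul_left _))
  rw [((hsum x).mul_left _).tsum_add ((hsum y).mul_left _), tsum_mul_left, tsum_mul_left] at hs
  calc Lfunction u (Real.exp (a * x + b * y)) ≤ E * (a / F) * F + E * (b / G) * G := hs
    _ = E * (a + b) := by field_simp
    _ = E := by rw [hab, mul_one]
end

section
/- Let u ∈ C_{+,log} be increasing. Then there exists a constant C > 0, depending only on u and not on k, such that for every k > 0 for which u is (log,x^k)-convex and every r ≥ 0, u(r) ≤ C · L_u(2^k r). -/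
open Real Filter Set

/-- Supporting line of a convex function on `[0,∞)` at a positive point. -/
theorem exists_support_line (f : ℝ → ℝ) (hf : ConvexOn ℝ (Set.Ici 0) f) (a : ℝ) (ha : 0 < a) :
    ∃ c : ℝ, ∀ x ≥ (0:ℝ), f a + c * (x - a) ≤ f x := by
  let S : Set ℝ := (fun x => (f a - f x) / (a - x)) '' Set.Ico 0 a
  have hub : ∀ z > a, ∀ s ∈ S, s ≤ (f z - f a) / (z - a) := by
    rintro z hz s ⟨x, hx, rfl⟩
    exact hf.slope_mono_adjacent (show x ∈ Set.Ici 0 from hx.1)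
      (show z ∈ Set.Ici 0 from (ha.trans hz).le) hx.2 hz
  have hne : S.Nonempty := ⟨_, 0, ⟨le_rfl, ha⟩, rfl⟩
  have hbdd : BddAbove S := ⟨_, hub (a + 1) (by linarith)⟩
  refine ⟨sSup S, fun x hx => ?_⟩
  rcases lt_trichotomy x a with h | h | h
  · have h1 : (f a - f x) / (a - x) ≤ sSup S := le_csSup hbdd ⟨x, ⟨hx, h⟩, rfl⟩
    rw [div_le_iff₀ (by linarith)] at h1
    linarith
  · subst h; simp
  · have h1 : sSup S ≤ (f x - f a) / (x - a) := csSup_le hne (hub x h)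
    rw [le_div_iff₀ (by linarith)] at h1
    linarith

theorem legendre_nonneg (u : ℝ → ℝ) (hpos : ∀ r ≥ (0:ℝ), 0 < u r) (t : ℝ) :
    0 ≤ legendreTransform u t := by
  apply Real.iInf_nonneg
  rintro ⟨r, hr⟩
  have hr' : (0:ℝ) < r := hr
  exact (div_pos (hpos r hr'.le) (Real.rpow_pos_of_pos hr' t)).le

theorem legendre_le (u : ℝ → ℝ) (hpos : ∀ r ≥ (0:ℝ), 0 < u r) (t : ℝ) (r : ℝ) (hr : 0 < r) :
    legendreTransform u t ≤ u r / r ^ t := by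
  refine ciInf_le (f := fun r : Set.Ioi (0:ℝ) => u r / (r : ℝ) ^ t) ⟨0, ?_⟩ ⟨r, hr⟩
  rintro _ ⟨⟨s, hs⟩, rfl⟩
  have hs' : (0:ℝ) < s := hs
  exact (div_pos (hpos s hs'.le) (Real.rpow_pos_of_pos hs' t)).le

theorem term_le_L (u : ℝ → ℝ) (hpos : ∀ r ≥ (0:ℝ), 0 < u r) (r : ℝ) (hr : 0 ≤ r) (n : ℕ) :
    legendreTransform u n * r ^ n ≤ Lfunction u r := by
  have hnn : ∀ m : ℕ, 0 ≤ legendreTransform u m * r ^ m := fun m =>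
    mul_nonneg (legendre_nonneg u hpos m) (pow_nonneg hr m)
  have hR : 0 < r + 1 := by linarith
  have hsum : Summable (fun m : ℕ => legendreTransform u m * r ^ m) := by
    refine Summable.of_nonneg_of_le hnn (fun m => ?_)
      ((summable_geometric_of_lt_one (r := r / (r + 1)) (by positivity)
        (by rw [div_lt_one hR]; linarith)).mul_left (u (r + 1)))
    have h := legendre_le u hpos m (r + 1) hR
    rw [Real.rpow_natCast] at h
    calc legendreTransform u m * r ^ m ≤ u (r + 1) / (r + 1) ^ m * r ^ m := by gcongr
      _ = u (r + 1) * (r / (r + 1)) ^ m := by rw [div_pow]; ring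
  exact hsum.le_tsum n (fun m _ => hnn m)

theorem main_ineq (y m z : ℝ) (hy : 0 ≤ y) (h1 : y ≤ m) (h2 : m ≤ 2 * y) (hz : 0 < z) :
    m * Real.log z ≤ y * (z - 1) + m * Real.log 2 := by
  have h : Real.log (z / 2) ≤ z / 2 - 1 := Real.log_le_sub_one_of_pos (by positivity)
  rw [Real.log_div hz.ne' (by norm_num)] at h
  have h3 : m * (Real.log z - Real.log 2) ≤ m * (z / 2 - 1) :=
    mul_le_mul_of_nonneg_left h (by linarith)
  rcases le_total 2 z with h4 | h4
  · nlinarith [mul_nonneg (sub_nonneg.2 h2) (sub_nonneg.2 h4)]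
  · nlinarith [mul_nonneg (sub_nonneg.2 h1) (sub_nonneg.2 h4), mul_nonneg hy hz.le]

/-- The main estimate for large `r`. -/
theorem large_case (u : ℝ → ℝ) (hpos : ∀ r ≥ (0:ℝ), 0 < u r) (k : ℝ) (hk : 0 < k)
    (hf : ConvexOn ℝ (Set.Ici 0) (fun x => Real.log (u (x ^ k)))) (r : ℝ) (hr : 1 < r)
    (hu : Real.log (u 1) + Real.log r ≤ Real.log (u r)) :
    u r ≤ Lfunction u ((2:ℝ) ^ k * r) := by
  have hr0 : 0 < r := by linarith
  have hlr : 0 < Real.log r := Real.log_pos hr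
  set a : ℝ := r ^ (1 / k) with ha_def
  have ha : 0 < a := Real.rpow_pos_of_pos hr0 _
  have hak : a ^ k = r := by
    rw [ha_def, ← Real.rpow_mul hr0.le, one_div_mul_cancel hk.ne', Real.rpow_one]
  have hla : k * Real.log a = Real.log r := by rw [← hak, Real.log_rpow ha]
  obtain ⟨c, hc⟩ := exists_support_line _ hf a ha
  simp only [hak] at hc
  have hc1 := hc 1 zero_le_one
  rw [Real.one_rpow] at hc1
  have hy : k ≤ c * a := by
    have h1 : Real.log r ≤ c * (a - 1) := by linarith
    have h2 : 1 - 1 / a ≤ Real.log a := by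
      simpa using Real.one_sub_inv_le_log_of_pos ha
    have h4 : a - 1 ≤ a * Real.log a := by
      have := mul_le_mul_of_nonneg_left h2 ha.le
      rwa [mul_sub, mul_one, mul_one_div_cancel ha.ne'] at this
    have hla0 : 0 < Real.log a := by
      by_contra h
      push Not at h
      nlinarith
    have ha1 : 0 < a - 1 := by
      have := Real.log_le_sub_one_of_pos ha
      linarith
    have hc0 : 0 ≤ c := by
      by_contra h
      push Not at h
      nlinarith
    have h5 : k * Real.log a ≤ (c * a) * Real.log a := by
      rw [hla]
      calc Real.log r ≤ c * (a - 1) := h1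
        _ ≤ c * (a * Real.log a) := mul_le_mul_of_nonneg_left h4 hc0
        _ = _ := by ring
    exact le_of_mul_le_mul_right h5 hla0
  set y := c * a with hy_def
  have hy0 : 0 < y := by linarith
  set n := ⌈y / k⌉₊ with hn
  have hn1 : y ≤ n * k := by
    have := Nat.le_ceil (y / k)
    rwa [div_le_iff₀ hk] at this
  have hn2 : n * k ≤ 2 * y := by
    have h1 := Nat.ceil_lt_add_one (a := y / k) (by positivity)
    have h2 := mul_lt_mul_of_pos_right h1 hk
    rw [add_mul, div_mul_cancel₀ _ hk.ne'] at h2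
    rw [← hn] at h2
    linarith
  have hB : 0 < (2:ℝ) ^ k * r := mul_pos (Real.rpow_pos_of_pos two_pos k) hr0
  refine le_trans ?_ (term_le_L u hpos _ hB.le n)
  rw [← div_le_iff₀ (pow_pos hB n)]
  have : Nonempty (Set.Ioi (0:ℝ)) := ⟨⟨1, Set.mem_Ioi.2 one_pos⟩⟩
  refine le_ciInf ?_
  rintro ⟨s, hs⟩
  have hs0 : (0:ℝ) < s := hs
  show u r / ((2:ℝ) ^ k * r) ^ n ≤ u s / s ^ (n:ℝ)
  rw [Real.rpow_natCast]
  have hur := hpos r hr0.le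
  have hus := hpos s hs0.le
  rw [← Real.log_le_log_iff (by positivity) (by positivity), Real.log_div hur.ne' (by positivity),
    Real.log_div hus.ne' (by positivity), Real.log_pow, Real.log_pow,
    Real.log_mul (by positivity) hr0.ne', Real.log_rpow two_pos]
  set x : ℝ := s ^ (1 / k) with hx_def
  have hx : 0 < x := Real.rpow_pos_of_pos hs0 _
  have hxk : x ^ k = s := by
    rw [hx_def, ← Real.rpow_mul hs0.le, one_div_mul_cancel hk.ne', Real.rpow_one]
  have hlx : k * Real.log x = Real.log s := by rw [← hxk, Real.log_rpow hx]
  have h1 := hc x hx.le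
  rw [hxk] at h1
  have h2 := main_ineq y (n * k) (x / a) hy0.le hn1 hn2 (by positivity)
  rw [Real.log_div hx.ne' ha.ne'] at h2
  have h3 : y * (x / a - 1) = c * (x - a) := by rw [hy_def]; field_simp
  rw [h3] at h2
  rw [← hlx, ← hla]
  linarith

/-- Let `u ∈ C_{+,log}` be increasing. Then there exists a constant `C > 0`,
depending only on `u` and not on `k`, such that for every `k > 0` for which `u` is
(log,x^k)-convex and every `r ≥ 0`, `u(r) ≤ C · L_u(2^k r)`. -/
theorem le_C_mul_Lfunction (u : ℝ → ℝ)
    (hpos : ∀ r ≥ (0:ℝ), 0 < u r)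
    (hcont : ContinuousOn u (Set.Ici 0))
    (hlog : Tendsto (fun r => Real.log (u r) / Real.log r) atTop atTop)
    (hmono : MonotoneOn u (Set.Ici 0)) :
    ∃ C > (0:ℝ), ∀ k > (0:ℝ),
      ConvexOn ℝ (Set.Ici 0) (fun x => Real.log (u (x ^ k))) →
      ∀ r ≥ (0:ℝ), u r ≤ C * Lfunction u ((2:ℝ) ^ k * r) := by
  obtain ⟨R, hR⟩ : ∃ R : ℝ, ∀ r ≥ R, 1 < r ∧ Real.log (u 1) + Real.log r ≤ Real.log (u r) := by
    rw [← Filter.eventually_atTop]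
    filter_upwards [hlog.eventually_ge_atTop 2, eventually_gt_atTop 1,
      Real.tendsto_log_atTop.eventually_ge_atTop (Real.log (u 1))] with r h1 h2 h3
    have hl := Real.log_pos h2
    rw [le_div_iff₀ hl] at h1
    exact ⟨h2, by linarith⟩
  have hR1 := (hR R le_rfl).1
  have hu0 := hpos 0 le_rfl
  have huR := hpos R (by linarith)
  refine ⟨max 1 (u R / u 0), by positivity, fun k hk hf r hr => ?_⟩
  have hB : 0 ≤ (2:ℝ) ^ k * r := mul_nonneg (Real.rpow_pos_of_pos two_pos k).le hr
  rcases le_total R r with h | h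
  · have h1 := large_case u hpos k hk hf r (hR r h).1 (hR r h).2
    have h2 : 0 < Lfunction u ((2:ℝ) ^ k * r) := (hpos r hr).trans_le h1
    nlinarith [le_max_left 1 (u R / u 0)]
  · have h0 : u 0 ≤ Lfunction u ((2:ℝ) ^ k * r) := by
      refine le_trans ?_ (term_le_L u hpos _ hB 0)
      have : Nonempty (Set.Ioi (0:ℝ)) := ⟨⟨1, Set.mem_Ioi.2 one_pos⟩⟩
      rw [pow_zero, mul_one]
      refine le_ciInf ?_
      rintro ⟨s, hs⟩
      have hs0 : (0:ℝ) < s := hs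
      simpa using hmono (Set.mem_Ici.2 le_rfl) (Set.mem_Ici.2 hs0.le) hs0.le
    calc u r ≤ u R := hmono hr (Set.mem_Ici.2 (by linarith)) h
      _ = u R / u 0 * u 0 := by field_simp
      _ ≤ max 1 (u R / u 0) * Lfunction u ((2:ℝ) ^ k * r) := by
        gcongr
        exact le_max_right _ _
end

section
/- Let u ∈ C_{+,1/2} be (log,x²)-convex. Then for every t > 0, the Legendre transform of the dual Legendre transform u* satisfies ℓ_{u*}(t) = e^{2t} / (ℓ_u(t) · t^{2t}). -/
open Real Filter Set

/-- The dual Legendre transform `u*(r) = sup_{s ≥ 0} e^{2√(rs)}/u(s)`. -/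
noncomputable def dualLegendreTransform (u : ℝ → ℝ) (r : ℝ) : ℝ :=
  ⨆ s : Set.Ici (0:ℝ), Real.exp (2 * Real.sqrt (r * s)) / u s

/-- The function `log u(s) - t log s` attains its minimum on `(0, ∞)`. -/
lemma exists_min_aux (u : ℝ → ℝ)
    (hpos : ∀ r ≥ (0:ℝ), 0 < u r)
    (hcont : ContinuousOn u (Set.Ici 0))
    (hhalf : Tendsto (fun r => Real.log (u r) / Real.sqrt r) atTop atTop)
    (t : ℝ) (ht : 0 < t) :
    ∃ r0 > 0, ∀ r > 0, Real.log (u r0) - t * Real.log r0 ≤ Real.log (u r) - t * Real.log r := by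
  have hlog : ContinuousOn (fun s => Real.log (u s)) (Set.Ici 0) :=
    hcont.log (fun x hx => (hpos x hx).ne')
  obtain ⟨m, -, hm⟩ := (isCompact_Icc (a := (0:ℝ)) (b := 1)).exists_isMinOn ⟨0, by simp⟩
    (hlog.mono (fun x hx => hx.1))
  obtain ⟨B, hB⟩ := (hhalf.eventually_ge_atTop (2 * t + |Real.log (u 1)|)).exists_forall_of_atTop
  set K := Real.log (u m) - Real.log (u 1) with hK
  have hK0 : K ≤ 0 := by
    have := hm (show (1:ℝ) ∈ Set.Icc (0:ℝ) 1 by simp)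
    simp only [Set.mem_setOf_eq] at this
    linarith
  set a := Real.exp (K / t) with ha
  have ha0 : 0 < a := Real.exp_pos _
  have ha1 : a ≤ 1 := by
    rw [ha, Real.exp_le_one_iff]
    exact div_nonpos_of_nonpos_of_nonneg hK0 ht.le
  have hc2 : ContinuousOn (fun s => Real.log (u s) - t * Real.log s) (Set.Icc a (max B 1)) := by
    refine ContinuousOn.sub (hlog.mono (fun x hx => ha0.le.trans hx.1)) ?_
    refine continuousOn_const.mul (continuousOn_id.log ?_)
    intro x hx
    exact (ha0.trans_le hx.1).ne'
  have h1 : (1:ℝ) ∈ Set.Icc a (max B 1) := ⟨ha1, le_max_right _ _⟩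
  obtain ⟨r0, hr0, hmin⟩ := isCompact_Icc.exists_isMinOn ⟨1, h1⟩ hc2
  have hmin' : ∀ x ∈ Set.Icc a (max B 1),
      Real.log (u r0) - t * Real.log r0 ≤ Real.log (u x) - t * Real.log x := fun x hx => hmin hx
  refine ⟨r0, ha0.trans_le hr0.1, fun r hr => ?_⟩
  have h11 := hmin' 1 h1
  simp only [Real.log_one, mul_zero, sub_zero] at h11
  by_cases h : r < a
  · refine h11.trans ?_
    have hmr : Real.log (u m) ≤ Real.log (u r) := hm (show r ∈ Set.Icc (0:ℝ) 1 from
      ⟨hr.le, (h.trans_le ha1).le⟩)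
    have : Real.log r ≤ K / t := by
      rw [← Real.log_exp (K / t)]
      exact Real.log_le_log hr h.le
    rw [le_div_iff₀ ht] at this
    linarith
  · by_cases h' : r ≤ max B 1
    · exact hmin' r ⟨not_lt.1 h, h'⟩
    · refine h11.trans ?_
      push Not at h'
      have hr1 : 1 < r := (le_max_right _ _).trans_lt h'
      have hs1 : 1 ≤ Real.sqrt r := Real.one_le_sqrt.2 hr1.le
      have h2 := hB r ((le_max_left _ _).trans h'.le)
      rw [le_div_iff₀ (by linarith)] at h2
      have h3 : Real.log r ≤ 2 * Real.sqrt r := by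
        have h4 := Real.log_le_sub_one_of_pos (show 0 < Real.sqrt r by linarith)
        rw [Real.log_sqrt hr.le] at h4
        linarith
      have h5 : t * Real.log r ≤ t * (2 * Real.sqrt r) := by gcongr
      have h6 := le_abs_self (Real.log (u 1))
      nlinarith [abs_nonneg (Real.log (u 1))]

/-- The family defining the dual Legendre transform is bounded above. -/
lemma bdd_aux (u : ℝ → ℝ)
    (hpos : ∀ r ≥ (0:ℝ), 0 < u r)
    (hcont : ContinuousOn u (Set.Ici 0))
    (hhalf : Tendsto (fun r => Real.log (u r) / Real.sqrt r) atTop atTop)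
    (r : ℝ) (hr : 0 ≤ r) :
    BddAbove (Set.range (fun s : Set.Ici (0:ℝ) => Real.exp (2 * Real.sqrt (r * s)) / u s)) := by
  obtain ⟨B, hB⟩ := (hhalf.eventually_ge_atTop (2 * Real.sqrt r)).exists_forall_of_atTop
  have hc : ContinuousOn (fun s => Real.exp (2 * Real.sqrt (r * s)) / u s)
      (Set.Icc 0 (max B 1)) := by
    refine ContinuousOn.div (by fun_prop) (hcont.mono (fun x hx => hx.1)) ?_
    intro x hx
    exact (hpos x hx.1).ne'
  obtain ⟨C, hC⟩ := isCompact_Icc.bddAbove_image hc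
  refine ⟨max C 1, ?_⟩
  rintro _ ⟨⟨s, hs⟩, rfl⟩
  have hs : 0 ≤ s := hs
  by_cases h : s ≤ max B 1
  · exact le_max_of_le_left (hC ⟨s, ⟨hs, h⟩, rfl⟩)
  · refine le_max_of_le_right ?_
    push Not at h
    have hs1 : 1 < s := (le_max_right _ _).trans_lt h
    have h2 := hB s ((le_max_left _ _).trans h.le)
    rw [le_div_iff₀ (Real.sqrt_pos.2 (by linarith))] at h2
    dsimp only
    rw [div_le_one (hpos s hs), ← Real.le_log_iff_exp_le (hpos s hs), Real.sqrt_mul hr]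
    linarith

/-- Tangent line inequality at the minimizer. -/
lemma tangent_aux (φ : ℝ → ℝ) (hφ : ConvexOn ℝ (Set.Ici 0) φ) (t x0 : ℝ) (ht : 0 < t)
    (hx0 : 0 < x0)
    (hmin : ∀ x > 0, φ x0 - 2 * t * Real.log x0 ≤ φ x - 2 * t * Real.log x)
    (x : ℝ) (hx : 0 ≤ x) : φ x0 + 2 * t * ((x - x0) / x0) ≤ φ x := by
  set d := (x - x0) / x0 with hd
  have hd1 : -1 ≤ d := by
    rw [hd, le_div_iff₀ hx0]; linarith
  have hxd : x = x0 * (1 + d) := by rw [hd]; field_simp; ring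
  have key : ∀ ε ∈ Set.Ioo (0:ℝ) 1, φ x0 + 2 * t * (d / (1 + ε * d)) ≤ φ x := by
    intro ε hε
    obtain ⟨h0, h1⟩ := hε
    have hp : 0 < 1 + ε * d := by nlinarith
    have h2 := hφ.2 (show x0 ∈ Set.Ici (0:ℝ) from hx0.le) (show x ∈ Set.Ici (0:ℝ) from hx)
      (show 0 ≤ 1 - ε by linarith) h0.le (by ring)
    simp only [smul_eq_mul] at h2
    have he : (1 - ε) * x0 + ε * x = x0 * (1 + ε * d) := by rw [hxd]; ring
    rw [he] at h2
    have h3 := hmin (x0 * (1 + ε * d)) (by positivity)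
    rw [Real.log_mul hx0.ne' hp.ne'] at h3
    have h4 := Real.one_sub_inv_le_log_of_pos hp
    have h5 : 1 - (1 + ε * d)⁻¹ = ε * (d / (1 + ε * d)) := by field_simp; ring
    rw [h5] at h4
    have h6 : 2 * t * (ε * (d / (1 + ε * d))) ≤ 2 * t * Real.log (1 + ε * d) := by gcongr
    have h7 : ε * (φ x0 + 2 * t * (d / (1 + ε * d))) ≤ ε * φ x := by linarith
    exact le_of_mul_le_mul_left h7 h0
  have hlim : Tendsto (fun ε : ℝ => φ x0 + 2 * t * (d / (1 + ε * d))) (nhdsWithin 0 (Set.Ioi 0))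
      (nhds (φ x0 + 2 * t * (d / (1 + 0 * d)))) := by
    apply tendsto_nhdsWithin_of_tendsto_nhds
    have : ContinuousAt (fun ε : ℝ => φ x0 + 2 * t * (d / (1 + ε * d))) 0 := by
      refine continuousAt_const.add (continuousAt_const.mul
        (continuousAt_const.div (by fun_prop) (by simp)))
    exact this.tendsto
  have := le_of_tendsto hlim (by
    filter_upwards [Ioo_mem_nhdsGT (show (0:ℝ) < 1 by norm_num)] with ε hε using key ε hε)
  simpa using this

/-- Let `u ∈ C_{+,1/2}` be (log,x²)-convex. Then for every `t > 0`, the Legendre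
transform of the dual Legendre transform `u*` satisfies
`ℓ_{u*}(t) = e^{2t} / (ℓ_u(t) · t^{2t})`. -/
theorem legendreTransform_dualLegendreTransform (u : ℝ → ℝ)
    (hpos : ∀ r ≥ (0:ℝ), 0 < u r)
    (hcont : ContinuousOn u (Set.Ici 0))
    (hhalf : Tendsto (fun r => Real.log (u r) / Real.sqrt r) atTop atTop)
    (hconv : ConvexOn ℝ (Set.Ici 0) (fun x => Real.log (u (x ^ (2:ℝ))))) :
    ∀ t > (0:ℝ),
      legendreTransform (dualLegendreTransform u) t =
        Real.exp (2 * t) / (legendreTransform u t * t ^ (2 * t)) := by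
  intro t ht
  obtain ⟨r0, hr0, hmin⟩ := exists_min_aux u hpos hcont hhalf t ht
  have hu0 := hpos r0 hr0.le
  have hL : legendreTransform u t = u r0 / r0 ^ t := by
    unfold legendreTransform
    have hle : ∀ r : Set.Ioi (0:ℝ), u r0 / r0 ^ t ≤ u r / (r : ℝ) ^ t := by
      rintro ⟨r, hr⟩
      have hr : 0 < r := hr
      have hur := hpos r hr.le
      have h := hmin r hr
      dsimp only
      rw [← Real.log_le_log_iff (by positivity) (by positivity),
        Real.log_div hu0.ne' (by positivity), Real.log_div hur.ne' (by positivity),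
        Real.log_rpow hr0, Real.log_rpow hr]
      exact h
    refine le_antisymm ?_ ?_
    · exact ciInf_le (f := fun r : Set.Ioi (0:ℝ) => u r / (r : ℝ) ^ t)
        ⟨_, by rintro _ ⟨r, rfl⟩; exact hle r⟩ ⟨r0, hr0⟩
    · haveI : Nonempty (Set.Ioi (0:ℝ)) := ⟨⟨1, by simp⟩⟩
      exact le_ciInf hle
  rw [hL]
  set x0 := Real.sqrt r0 with hx0d
  have hx0 : 0 < x0 := Real.sqrt_pos.2 hr0
  have hx0s : x0 ^ 2 = r0 := Real.sq_sqrt hr0.le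
  have htan := tangent_aux _ hconv t x0 ht hx0 (by
    intro x hx
    have h := hmin (x ^ 2) (by positivity)
    rw [← hx0s, Real.log_pow, Real.log_pow] at h
    simp only [Real.rpow_two]
    push_cast at h
    linarith)
  simp only [Real.rpow_two, hx0s] at htan
  -- lower bound
  have hlow : ∀ r : Set.Ioi (0:ℝ), Real.exp (2 * t) / (u r0 / r0 ^ t * t ^ (2 * t)) ≤
      dualLegendreTransform u r / (r : ℝ) ^ t := by
    rintro ⟨r, hr⟩
    have hr : 0 < r := hr
    dsimp only
    have h1 : Real.exp (2 * Real.sqrt (r * r0)) / u r0 ≤ dualLegendreTransform u r :=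
      le_ciSup (bdd_aux u hpos hcont hhalf r hr.le) ⟨r0, hr0.le⟩
    refine le_trans ?_ (div_le_div_of_nonneg_right h1 (by positivity))
    rw [← Real.log_le_log_iff (by positivity) (by positivity)]
    rw [Real.log_div (by positivity) (by positivity), Real.log_mul (by positivity) (by positivity),
      Real.log_div (by positivity) (by positivity), Real.log_div (by positivity) (by positivity),
      Real.log_div (by positivity) (by positivity), Real.log_exp, Real.log_exp,
      Real.log_rpow hr0, Real.log_rpow hr, Real.log_rpow ht]
    set z := Real.sqrt (r * r0) with hz
    have hz0 : 0 < z := Real.sqrt_pos.2 (by positivity)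
    have hlz : Real.log z = (Real.log r + Real.log r0) / 2 := by
      rw [hz, Real.log_sqrt (by positivity), Real.log_mul hr.ne' hr0.ne']
    have h2 := Real.log_le_sub_one_of_pos (show 0 < z / t by positivity)
    rw [Real.log_div hz0.ne' ht.ne', hlz] at h2
    have h3 := mul_le_mul_of_nonneg_left h2 ht.le
    have h4 : t * (z / t - 1) = z - t := by field_simp
    rw [h4] at h3
    linarith
  unfold legendreTransform
  refine le_antisymm ?_ ?_
  · have hy : (0:ℝ) < t ^ 2 / r0 := by positivity
    refine (ciInf_le (f := fun r : Set.Ioi (0:ℝ) => dualLegendreTransform u r / (r : ℝ) ^ t)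
        ⟨_, by rintro _ ⟨r, rfl⟩; exact hlow r⟩ ⟨t ^ 2 / r0, hy⟩).trans ?_
    dsimp only
    have hD : dualLegendreTransform u (t ^ 2 / r0) ≤ Real.exp (2 * t) / u r0 := by
      unfold dualLegendreTransform
      haveI : Nonempty (Set.Ici (0:ℝ)) := ⟨⟨1, by simp⟩⟩
      refine ciSup_le ?_
      rintro ⟨s, hs⟩
      have hs : 0 ≤ s := hs
      have hus := hpos s hs
      dsimp only
      have h1 := htan (Real.sqrt s) (Real.sqrt_nonneg s)
      rw [Real.sq_sqrt hs] at h1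
      have h2 : Real.sqrt (t ^ 2 / r0 * s) = t / x0 * Real.sqrt s := by
        rw [Real.sqrt_mul hy.le, Real.sqrt_div (by positivity), Real.sqrt_sq ht.le]
      have h3 : 2 * t * ((Real.sqrt s - x0) / x0) = 2 * (t / x0 * Real.sqrt s) - 2 * t := by
        field_simp
      rw [h2, ← Real.log_le_log_iff (by positivity) (by positivity),
        Real.log_div (by positivity) (by positivity), Real.log_div (by positivity) (by positivity),
        Real.log_exp, Real.log_exp]
      linarith
    refine (div_le_div_of_nonneg_right hD (by positivity)).trans (le_of_eq ?_)
    have h5 : (t ^ 2 / r0) ^ t = t ^ (2 * t) / r0 ^ t := by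
      rw [Real.div_rpow (by positivity) hr0.le, Real.rpow_mul ht.le, Real.rpow_two]
    rw [h5]
    field_simp
  · haveI : Nonempty (Set.Ioi (0:ℝ)) := ⟨⟨1, by simp⟩⟩
    exact le_ciInf hlow
end

section
/- For every u ∈ C_{+,1/2} and every r ≥ 0, the dual Legendre transform u*(r) = sup_{s≥0} e^{2√(rs)}/u(s) is finite. -/
open Real Filter Set

/-- For every `u ∈ C_{+,1/2}` and every `r ≥ 0`, the dual Legendre transform
`u*(r) = sup_{s ≥ 0} e^{2√(rs)}/u(s)` is finite, i.e. the set of values is bounded above. -/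
theorem dualLegendreTransform_finite (u : ℝ → ℝ)
    (hpos : ∀ r ≥ (0:ℝ), 0 < u r)
    (hcont : ContinuousOn u (Set.Ici 0))
    (hhalf : Tendsto (fun r => Real.log (u r) / Real.sqrt r) atTop atTop) :
    ∀ r ≥ (0:ℝ),
      BddAbove {y : ℝ | ∃ s ≥ (0:ℝ), y = Real.exp (2 * Real.sqrt (r * s)) / u s} := by
  intro r hr
  obtain ⟨M, hM⟩ := (tendsto_atTop.mp hhalf (2 * Real.sqrt r)).exists_forall_of_atTop
  have hc : ContinuousOn (fun s => Real.exp (2 * Real.sqrt (r * s)) / u s)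
      (Set.Icc 0 (max M 1)) := by
    apply ContinuousOn.div
    · fun_prop
    · exact hcont.mono (fun x hx => hx.1)
    · intro x hx
      exact (hpos x hx.1).ne'
  obtain ⟨B, hB⟩ := isCompact_Icc.bddAbove_image hc
  refine ⟨max B 1, ?_⟩
  rintro y ⟨s, hs, rfl⟩
  rcases le_total s (max M 1) with h | h
  · exact le_max_of_le_left (hB ⟨s, ⟨hs, h⟩, rfl⟩)
  · apply le_max_of_le_right
    have h1 : M ≤ s := (le_max_left _ _).trans h
    have h2 : (0:ℝ) < s := lt_of_lt_of_le one_pos ((le_max_right _ _).trans h)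
    have h3 := hM s h1
    rw [le_div_iff₀ (Real.sqrt_pos.mpr h2)] at h3
    rw [div_le_one (hpos s hs), ← Real.le_log_iff_exp_le (hpos s hs), Real.sqrt_mul hr]
    linarith
end

section
/- For 0 ≤ β < 1, the function u(r) = exp((1+β) r^{1/(1+β)}) has dual Legendre transform u*(r) = exp((1−β) r^{1/(1−β)}); that is, for every r ≥ 0, sup_{s≥0} exp(2√(rs) − (1+β) s^{1/(1+β)}) = exp((1−β) r^{1/(1−β)}). -/
open Real Filter Set

/-- For `0 ≤ β < 1`, the function `u(r) = exp((1+β) r^{1/(1+β)})` has dual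
Legendre transform `u*(r) = exp((1−β) r^{1/(1−β)})`; that is, for every `r ≥ 0`,
`sup_{s ≥ 0} exp(2√(rs) − (1+β) s^{1/(1+β)}) = exp((1−β) r^{1/(1−β)})`. -/
theorem dualLegendre_kondratiev (β : ℝ) (hβ0 : 0 ≤ β) (hβ1 : β < 1) (r : ℝ) (hr : 0 ≤ r) :
    (⨆ s : Set.Ici (0:ℝ),
        Real.exp (2 * Real.sqrt (r * s) - (1 + β) * (s : ℝ) ^ (1 / (1 + β)))) =
      Real.exp ((1 - β) * r ^ (1 / (1 - β))) := by
  have h1 : 0 < 1 - β := by linarith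
  have h2 : 0 < 1 + β := by linarith
  have key : ∀ s : Set.Ici (0:ℝ),
      Real.exp (2 * Real.sqrt (r * s) - (1 + β) * (s : ℝ) ^ (1 / (1 + β))) ≤
      Real.exp ((1 - β) * r ^ (1 / (1 - β))) := by
    rintro ⟨s, hs⟩
    have hs : 0 ≤ s := hs
    apply Real.exp_le_exp.mpr
    have h := Real.geom_mean_le_arith_mean2_weighted
      (w₁ := (1 - β) / 2) (w₂ := (1 + β) / 2)
      (by positivity) (by positivity) (Real.rpow_nonneg hr (1 / (1 - β)))
      (Real.rpow_nonneg hs (1 / (1 + β))) (by ring)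
    rw [← Real.rpow_mul hr, ← Real.rpow_mul hs,
      show 1 / (1 - β) * ((1 - β) / 2) = 1 / 2 by field_simp,
      show 1 / (1 + β) * ((1 + β) / 2) = 1 / 2 by field_simp,
      ← Real.sqrt_eq_rpow, ← Real.sqrt_eq_rpow, ← Real.sqrt_mul hr] at h
    dsimp only
    linarith
  apply le_antisymm
  · haveI : Nonempty (Set.Ici (0:ℝ)) := ⟨⟨0, Set.mem_Ici.mpr le_rfl⟩⟩
    exact ciSup_le key
  · have hbdd : BddAbove (Set.range fun s : Set.Ici (0:ℝ) =>
        Real.exp (2 * Real.sqrt (r * s) - (1 + β) * (s : ℝ) ^ (1 / (1 + β)))) :=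
      ⟨_, by rintro _ ⟨s, rfl⟩; exact key s⟩
    refine le_trans (le_of_eq ?_)
      (le_ciSup hbdd ⟨r ^ ((1 + β) / (1 - β)), Real.rpow_nonneg hr _⟩)
    dsimp only
    have e1 : r * r ^ ((1 + β) / (1 - β)) = (r ^ (1 / (1 - β))) ^ 2 := by
      rw [← Real.rpow_natCast, ← Real.rpow_mul hr,
        show 1 / (1 - β) * ((2 : ℕ) : ℝ) = 1 + (1 + β) / (1 - β) by
          push_cast; field_simp; ring,
        Real.rpow_add_of_nonneg hr zero_le_one (by positivity), Real.rpow_one]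
    rw [e1, Real.sqrt_sq (Real.rpow_nonneg hr _), ← Real.rpow_mul hr,
      show (1 + β) / (1 - β) * (1 / (1 + β)) = 1 / (1 - β) by field_simp]
    congr 1
    ring
end

section
/- Let v(r) = exp(e^r − 1) for r ≥ 0 and let u = v* be its dual Legendre transform. Then v ∈ C_{+,1/2}, u(0) = sup_{s≥0} v(s)^{-1} = 1, u belongs to C_{+,1/2}, and u is an increasing (log,x²)-convex function on [0,∞). -/
open Real Filter Set

/-- The exponent inside the supremum, as a function of `x = √r`. -/
noncomputable def expExpAux (x : ℝ) (s : Set.Ici (0:ℝ)) : ℝ :=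
  2 * x * Real.sqrt s - (Real.exp s - 1)

/-- The Legendre-type supremum. -/
noncomputable def expExpSup (x : ℝ) : ℝ := ⨆ s : Set.Ici (0:ℝ), expExpAux x s

lemma expExpAux_le (x : ℝ) (s : Set.Ici (0:ℝ)) : expExpAux x s ≤ x ^ 2 := by
  have h1 := Real.add_one_le_exp (s : ℝ)
  have h2 := Real.sq_sqrt (show (0:ℝ) ≤ s from s.2)
  unfold expExpAux
  nlinarith [sq_nonneg (x - Real.sqrt s)]

lemma expExp_bdd (x : ℝ) : BddAbove (Set.range (expExpAux x)) :=
  ⟨x ^ 2, by rintro _ ⟨s, rfl⟩; exact expExpAux_le x s⟩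

lemma le_expExpSup (x : ℝ) (s : Set.Ici (0:ℝ)) : expExpAux x s ≤ expExpSup x :=
  le_ciSup (expExp_bdd x) s

lemma expExpSup_nonneg (x : ℝ) : 0 ≤ expExpSup x := by
  have := le_expExpSup x ⟨0, by simp⟩
  simpa [expExpAux] using this

lemma expExpSup_zero : expExpSup 0 = 0 := by
  refine le_antisymm (ciSup_le fun s => ?_) (expExpSup_nonneg 0)
  simpa using expExpAux_le 0 s

lemma expExpSup_convex : ConvexOn ℝ Set.univ expExpSup := by
  refine ⟨convex_univ, fun x _ y _ a b ha hb hab => ciSup_le fun s => ?_⟩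
  have hx := mul_le_mul_of_nonneg_left (le_expExpSup x s) ha
  have hy := mul_le_mul_of_nonneg_left (le_expExpSup y s) hb
  have e : expExpAux (a • x + b • y) s = a * expExpAux x s + b * expExpAux y s := by
    have : b = 1 - a := by linarith
    subst this
    simp only [expExpAux, smul_eq_mul]
    ring
  rw [e]
  simpa using add_le_add hx hy

lemma expExpSup_continuous : Continuous expExpSup := by
  rw [← continuousOn_univ]
  exact expExpSup_convex.continuousOn isOpen_univ

lemma expExpSup_mono : Monotone expExpSup := by
  intro x y hxy
  refine ciSup_le fun s => le_trans ?_ (le_expExpSup y s)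
  unfold expExpAux
  have := mul_le_mul_of_nonneg_right hxy (Real.sqrt_nonneg (s : ℝ))
  linarith

lemma dual_eq (v : ℝ → ℝ) (hv : ∀ r : ℝ, v r = Real.exp (Real.exp r - 1)) (r : ℝ) (hr : 0 ≤ r) :
    dualLegendreTransform v r = Real.exp (expExpSup (Real.sqrt r)) := by
  unfold dualLegendreTransform expExpSup
  rw [Monotone.map_ciSup_of_continuousAt Real.continuous_exp.continuousAt Real.exp_monotone
    (expExp_bdd _)]
  refine iSup_congr fun s => ?_
  rw [hv, ← Real.exp_sub, Real.sqrt_mul hr, expExpAux, mul_assoc]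

/-- Let `v(r) = exp(e^r − 1)` and let `u = v*` be its dual Legendre transform.
Then `v ∈ C_{+,1/2}`, `u(0) = sup_{s ≥ 0} v(s)⁻¹ = 1`, `u` belongs to `C_{+,1/2}`, and `u` is
an increasing (log,x²)-convex function on `[0,∞)`. -/
theorem dual_of_exp_exp (v u : ℝ → ℝ)
    (hv : ∀ r : ℝ, v r = Real.exp (Real.exp r - 1))
    (hu : u = dualLegendreTransform v) :
    Tendsto (fun r => Real.log (v r) / Real.sqrt r) atTop atTop
    ∧ u 0 = (⨆ s : Set.Ici (0:ℝ), (v s)⁻¹)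
    ∧ u 0 = 1
    ∧ (∀ r ≥ (0:ℝ), 0 < u r)
    ∧ ContinuousOn u (Set.Ici 0)
    ∧ Tendsto (fun r => Real.log (u r) / Real.sqrt r) atTop atTop
    ∧ MonotoneOn u (Set.Ici 0)
    ∧ ConvexOn ℝ (Set.Ici 0) (fun x => Real.log (u (x ^ 2))) := by
  have hU : ∀ r : ℝ, 0 ≤ r → u r = Real.exp (expExpSup (Real.sqrt r)) := by
    intro r hr
    rw [hu]
    exact dual_eq v hv r hr
  have h0 : u 0 = 1 := by
    rw [hU 0 le_rfl, Real.sqrt_zero, expExpSup_zero, Real.exp_zero]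
  refine ⟨?_, ?_, h0, ?_, ?_, ?_, ?_, ?_⟩
  · refine tendsto_atTop_mono' atTop ?_ Real.tendsto_sqrt_atTop
    filter_upwards [eventually_ge_atTop (0:ℝ)] with r hr
    rw [hv, Real.log_exp]
    have h1 := Real.add_one_le_exp r
    calc Real.sqrt r = r / Real.sqrt r := Real.div_sqrt.symm
      _ ≤ _ := div_le_div_of_nonneg_right (by linarith) (Real.sqrt_nonneg r)
  · rw [hu]
    unfold dualLegendreTransform
    refine iSup_congr fun s => ?_
    simp
  · intro r hr
    rw [hU r hr]
    exact Real.exp_pos _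
  · refine ContinuousOn.congr (f := fun r => Real.exp (expExpSup (Real.sqrt r))) ?_
      (fun r hr => hU r hr)
    exact (Real.continuous_exp.comp
      (expExpSup_continuous.comp Real.continuous_sqrt)).continuousOn
  · have key : Tendsto (fun x => expExpSup x / x) atTop atTop := by
      rw [tendsto_atTop]
      intro M
      set N := |M| + 1 with hN
      have hN0 : 0 < N := by positivity
      have hMN : M ≤ N := by linarith [le_abs_self M]
      filter_upwards [eventually_ge_atTop ((Real.exp (N ^ 2) - 1) / N),
        eventually_gt_atTop (0:ℝ)] with x hx hx0
      rw [div_le_iff₀ hN0] at hx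
      rw [le_div_iff₀ hx0]
      have h := le_expExpSup x ⟨N ^ 2, by simp only [Set.mem_Ici]; positivity⟩
      simp only [expExpAux, Real.sqrt_sq hN0.le] at h
      nlinarith
    refine (key.comp Real.tendsto_sqrt_atTop).congr' ?_
    filter_upwards [eventually_ge_atTop (0:ℝ)] with r hr
    rw [hU r hr, Real.log_exp]
    rfl
  · intro a ha b hb hab
    rw [hU a ha, hU b hb]
    exact Real.exp_monotone (expExpSup_mono (Real.sqrt_le_sqrt hab))
  · refine (expExpSup_convex.subset (Set.subset_univ _) (convex_Ici 0)).congr ?_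
    intro x hx
    simp only
    rw [hU _ (sq_nonneg x), Real.log_exp, Real.sqrt_sq hx]
end
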